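/- Let G be a signed graph with edge set E and a fixed orientation, and let Γ be a finite additive abelian group of order k. Then the number of nowhere-zero Γ-flows in G equals Σ_{F ⊆ E} (−1)^{|F|} · 2^{ε(Γ)·κ(G−F)} · k^{β(G−F)}. -/

import Mathlib

/-- A signed graph: each edge `e` has endpoints `a e`, `b e` (equal for a loop)
and a sign `sign e ∈ {1, -1}`. -/
structure SignedGraph (V E : Type) where
  a : E → V
  b : E → V
  sign : E → ℤ
  sign_unit : ∀ e, sign e = 1 ∨ sign e = -1

namespace SignedGraph

variable {V E : Type}

/-- An orientation of a signed graph: incidence signs `ηa e`, `ηb e ∈ {1,-1}` at the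
two ends of each edge, with `ηa e * ηb e = - sign e`. -/
structure Orientation (G : SignedGraph V E) where
  ηa : E → ℤ
  ηb : E → ℤ
  ηa_unit : ∀ e, ηa e = 1 ∨ ηa e = -1
  ηb_unit : ∀ e, ηb e = 1 ∨ ηb e = -1
  compat : ∀ e, ηa e * ηb e = - G.sign e

/-- Kirchhoff's law at every vertex: a `Γ`-flow. -/
def IsFlow [Fintype E] [DecidableEq V] {Γ : Type} [AddCommGroup Γ]
    (G : SignedGraph V E) (O : G.Orientation) (f : E → Γ) : Prop :=
  ∀ v : V, ∑ e : E,
    ((if G.a e = v then O.ηa e else 0) + (if G.b e = v then O.ηb e else 0)) • f e = 0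

/-- Degree of a vertex in the subgraph with edge set `S` (a loop counts twice). -/
def deg [DecidableEq V] (G : SignedGraph V E) (S : Finset E) (v : V) : ℕ :=
  ∑ e ∈ S, ((if G.a e = v then 1 else 0) + (if G.b e = v then 1 else 0))

/-- Adjacency via an edge in the edge set `S`. -/
def AdjIn (G : SignedGraph V E) (S : Finset E) (v w : V) : Prop :=
  ∃ e ∈ S, (G.a e = v ∧ G.b e = w) ∨ (G.a e = w ∧ G.b e = v)

/-- A circuit: a nonempty edge set forming a connected 2-regular subgraph. -/
def IsCircuit [DecidableEq V] (G : SignedGraph V E) (C : Finset E) : Prop :=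
  C.Nonempty ∧
  (∀ v : V, (∃ e ∈ C, G.a e = v ∨ G.b e = v) → G.deg C v = 2) ∧
  (∀ v w : V, (∃ e ∈ C, G.a e = v ∨ G.b e = v) → (∃ e ∈ C, G.a e = w ∨ G.b e = w) →
     Relation.ReflTransGen (G.AdjIn C) v w)

/-- An unbalanced circuit: a circuit with an odd number of negative edges. -/
def IsUnbalancedCircuit [DecidableEq V] (G : SignedGraph V E) (C : Finset E) : Prop :=
  G.IsCircuit C ∧ Odd (C.filter (fun e => G.sign e = -1)).card

/-- The subgraph with edge set `S` is balanced (contains no unbalanced circuit). -/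
def BalancedOn [DecidableEq V] (G : SignedGraph V E) (S : Finset E) : Prop :=
  ∀ C : Finset E, C ⊆ S → ¬ G.IsUnbalancedCircuit C

/-- A balanced signed graph: contains no unbalanced circuit. -/
def Balanced [DecidableEq V] (G : SignedGraph V E) : Prop :=
  ∀ C : Finset E, ¬ G.IsUnbalancedCircuit C

/-- An unbalanced signed graph: contains an unbalanced circuit. -/
def Unbalanced [DecidableEq V] (G : SignedGraph V E) : Prop :=
  ∃ C : Finset E, G.IsUnbalancedCircuit C

/-- Adjacency in the whole signed graph. -/
def Adj (G : SignedGraph V E) (v w : V) : Prop :=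
  ∃ e : E, (G.a e = v ∧ G.b e = w) ∨ (G.a e = w ∧ G.b e = v)

/-- A connected signed graph: every two vertices are joined by a walk. -/
def Connected (G : SignedGraph V E) : Prop :=
  ∀ v w : V, Relation.ReflTransGen G.Adj v w

/-- The setoid on vertices whose classes are the connected components. -/
def compSetoid (G : SignedGraph V E) : Setoid V :=
  ⟨Relation.EqvGen G.Adj, Relation.EqvGen.is_equivalence _⟩

/-- The connected component of a vertex. -/
def component (G : SignedGraph V E) (v : V) : Quotient G.compSetoid :=
  Quotient.mk G.compSetoid v

/-- The number of vertices of a connected component. -/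
noncomputable def compN (G : SignedGraph V E) (q : Quotient G.compSetoid) : ℕ :=
  Nat.card {v : V // G.component v = q}

/-- The number of edges of a connected component. -/
noncomputable def compM (G : SignedGraph V E) (q : Quotient G.compSetoid) : ℕ :=
  Nat.card {e : E // G.component (G.a e) = q}

/-- The connected component `q` is unbalanced (contains an unbalanced circuit). -/
def CompUnbalanced [DecidableEq V] (G : SignedGraph V E) (q : Quotient G.compSetoid) : Prop :=
  ∃ C : Finset E, G.IsUnbalancedCircuit C ∧ ∃ e ∈ C, G.component (G.a e) = q

open Classical in
/-- `β` of a connected component: `m - n` if unbalanced, `m - n + 1` if balanced. -/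
noncomputable def compBeta [DecidableEq V] (G : SignedGraph V E)
    (q : Quotient G.compSetoid) : ℕ :=
  if G.CompUnbalanced q then G.compM q - G.compN q else G.compM q + 1 - G.compN q

/-- `β(G)`: the sum of `β(ω)` over the connected components `ω` of `G`. -/
noncomputable def beta [DecidableEq V] (G : SignedGraph V E) : ℕ :=
  ∑ᶠ q : Quotient G.compSetoid, G.compBeta q

/-- `κ(G)`: the number of unbalanced connected components of `G`. -/
noncomputable def kappa [DecidableEq V] (G : SignedGraph V E) : ℕ :=
  Nat.card {q : Quotient G.compSetoid // G.CompUnbalanced q}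

/-- The signed graph `G - F` obtained by deleting the edges in `F` (all vertices kept). -/
def delete [DecidableEq E] (G : SignedGraph V E) (F : Finset E) :
    SignedGraph V {e : E // e ∉ F} :=
  ⟨fun e => G.a e.1, fun e => G.b e.1, fun e => G.sign e.1, fun e => G.sign_unit e.1⟩

/-- The edges with both endpoints in `X` (the edge set of `G[X]`). -/
def insideEdges [Fintype E] [DecidableEq V] (G : SignedGraph V E) (X : Finset V) : Finset E :=
  Finset.univ.filter (fun e => G.a e ∈ X ∧ G.b e ∈ X)

/-- The edges with one endpoint in `X` and one outside: `[X, Xᶜ]`. -/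
def crossEdges [Fintype E] [DecidableEq V] (G : SignedGraph V E) (X : Finset V) : Finset E :=
  Finset.univ.filter (fun e => (G.a e ∈ X ∧ G.b e ∉ X) ∨ (G.a e ∉ X ∧ G.b e ∈ X))

/-- A cut: a nonempty set `B = [X, Xᶜ] ∪ E_X` where `X` is a nonempty vertex set and `E_X`
is a set of edges of `G[X]` minimal with `G[X] - E_X` balanced. -/
def IsCut [Fintype E] [DecidableEq V] [DecidableEq E]
    (G : SignedGraph V E) (B : Finset E) : Prop :=
  B.Nonempty ∧ ∃ X : Finset V, X.Nonempty ∧ ∃ EX : Finset E,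
    EX ⊆ G.insideEdges X ∧
    G.BalancedOn (G.insideEdges X \ EX) ∧
    (∀ EX' ⊆ EX, G.BalancedOn (G.insideEdges X \ EX') → EX' = EX) ∧
    B = G.crossEdges X ∪ EX

/-- A bond: a cut that is minimal (under inclusion) among cuts. -/
def IsBond [Fintype E] [DecidableEq V] [DecidableEq E]
    (G : SignedGraph V E) (B : Finset E) : Prop :=
  G.IsCut B ∧ ∀ B' ⊆ B, G.IsCut B' → B' = B

/-- A broken bond: a bond minus its largest edge (w.r.t. the linear order on `E`). -/
def IsBrokenBond [Fintype E] [DecidableEq V] [LinearOrder E]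
    (G : SignedGraph V E) (D : Finset E) : Prop :=
  ∃ B : Finset E, G.IsBond B ∧ ∃ h : B.Nonempty, D = B.erase (B.max' h)

/-- `F` contains no broken bond of `G` as a subset. -/
def NoBrokenBond [Fintype E] [DecidableEq V] [LinearOrder E]
    (G : SignedGraph V E) (F : Finset E) : Prop :=
  ∀ D : Finset E, G.IsBrokenBond D → ¬ D ⊆ F

end SignedGraph

/-- `ε(Γ)`: the largest `d` such that `Γ` has a subgroup isomorphic to `(ℤ/2ℤ)^d`. -/
noncomputable def epsilon (Γ : Type) [AddCommGroup Γ] [Fintype Γ] : ℕ :=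
  sSup {d : ℕ | ∃ H : AddSubgroup Γ, Nonempty (H ≃+ (Fin d → ZMod 2))}

namespace SignedGraph

theorem sum_deg {V E : Type} [Fintype V] [DecidableEq V] (G : SignedGraph V E) (S : Finset E) :
    ∑ v, G.deg S v = 2 * S.card := by
  unfold deg
  rw [Finset.sum_comm]
  simp [Finset.sum_add_distrib, mul_comm]

theorem deg_mono {V E : Type} [DecidableEq V] (G : SignedGraph V E) {S T : Finset E}
    (h : S ⊆ T) (v : V) : G.deg S v ≤ G.deg T v :=
  Finset.sum_le_sum_of_subset h

theorem deg_eq_zero_iff {V E : Type} [DecidableEq V] (G : SignedGraph V E) (S : Finset E)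
    (v : V) : G.deg S v = 0 ↔ ¬ ∃ e ∈ S, G.a e = v ∨ G.b e = v := by
  unfold deg
  rw [Finset.sum_eq_zero_iff]
  push Not
  refine forall₂_congr fun e _ => ?_
  by_cases h1 : G.a e = v <;> by_cases h2 : G.b e = v <;> simp [h1, h2]

theorem deg_sdiff_add {V E : Type} [DecidableEq V] [DecidableEq E] (G : SignedGraph V E)
    {D C : Finset E} (h : D ⊆ C) (v : V) : G.deg (C \ D) v + G.deg D v = G.deg C v :=
  Finset.sum_sdiff h

theorem natCast_deg_filter {V E : Type} [DecidableEq V] (G : SignedGraph V E) (S : Finset E)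
    (g : E → ZMod 2) (v : V) :
    (G.deg (S.filter fun e => g e ≠ 0) v : ZMod 2) =
      ∑ e ∈ S, g e * ((if G.a e = v then 1 else 0) + (if G.b e = v then 1 else 0)) := by
  unfold deg
  rw [Finset.sum_filter, Nat.cast_sum]
  refine Finset.sum_congr rfl fun e _ => ?_
  have h2 : ∀ x : ZMod 2, x ≠ 0 → x = 1 := by decide
  by_cases h : g e = 0
  · simp [h]
  · simp [h2 _ h]

/-- A system of sign equations without solution contains an even subgraph with an odd number of
negative edges. -/
theorem exists_even_odd_of_not_switchable {V E : Type} [Fintype V] [DecidableEq V] [Fintype E]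
    (G : SignedGraph V E) (S : Finset E)
    (h : ¬ ∃ s : V → ZMod 2, ∀ e ∈ S,
      s (G.a e) + s (G.b e) = if G.sign e = -1 then 1 else 0) :
    ∃ D ⊆ S, (∀ v, Even (G.deg D v)) ∧ Odd (D.filter fun e => G.sign e = -1).card := by
  classical
  let π : V → (V → ZMod 2) →ₗ[ZMod 2] ZMod 2 := LinearMap.proj
  let φ : (V → ZMod 2) →ₗ[ZMod 2] (E → ZMod 2) := LinearMap.pi fun e =>
    if e ∈ S then π (G.a e) + π (G.b e) else 0
  let τ : E → ZMod 2 := fun e => if e ∈ S then (if G.sign e = -1 then 1 else 0) else 0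
  have hτ : τ ∉ LinearMap.range φ := by
    rintro ⟨s, hs⟩
    refine h ⟨s, fun e he => ?_⟩
    simpa [φ, π, τ, he] using congrFun hs e
  obtain ⟨g, hg, hle⟩ := Submodule.exists_le_ker_of_notMem hτ
  obtain ⟨c, hsum⟩ : ∃ c : E → ZMod 2, ∀ x, g x = ∑ e, x e * c e :=
    ⟨_, LinearMap.pi_apply_eq_sum_univ g⟩
  refine ⟨S.filter fun e => c e ≠ 0, Finset.filter_subset _ _, fun v => ?_, ?_⟩
  · rw [← ZMod.natCast_eq_zero_iff_even, natCast_deg_filter]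
    have h1 : g (φ (Pi.single v 1)) = 0 := hle ⟨_, rfl⟩
    rw [hsum] at h1
    refine Eq.trans ?_ h1
    rw [← Finset.sum_filter_add_sum_filter_not Finset.univ (· ∈ S), Finset.filter_univ_mem,
      Finset.sum_eq_zero (s := Finset.univ.filter (· ∉ S)), add_zero]
    · refine Finset.sum_congr rfl fun e he => ?_
      simp [φ, π, he, Pi.single_apply, mul_comm]
    · intro e he
      simp [φ, (Finset.mem_filter.1 he).2]
  · rw [← ZMod.natCast_eq_one_iff_odd]
    rw [hsum] at hg
    have h2 : ∀ x : ZMod 2, x ≠ 0 → x = 1 := by decide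
    rw [← h2 _ hg, Finset.filter_filter, Finset.card_filter, Nat.cast_sum,
      ← Finset.sum_filter_add_sum_filter_not Finset.univ (· ∈ S), Finset.filter_univ_mem,
      Finset.sum_eq_zero (s := Finset.univ.filter (· ∉ S)), add_zero]
    · refine Finset.sum_congr rfl fun e he => ?_
      by_cases h3 : c e = 0
      · simp [h3]
      · by_cases h4 : G.sign e = -1 <;> simp [τ, he, h2 _ h3, h4]
    · intro e he
      simp [τ, (Finset.mem_filter.1 he).2]

/-- An even subgraph with an odd number of negative edges contains an unbalanced circuit. -/
theorem exists_unbalancedCircuit_of_even_odd {V E : Type} [Fintype V] [DecidableEq V]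
    (G : SignedGraph V E) (D : Finset E) (hD : ∀ v, Even (G.deg D v))
    (hodd : Odd (D.filter fun e => G.sign e = -1).card) :
    ∃ C ⊆ D, G.IsUnbalancedCircuit C := by
  classical
  obtain ⟨C, hCD, hmin⟩ := exists_minimal_le_of_wellFoundedLT
    (fun C : Finset E => (∀ v, Even (G.deg C v)) ∧ Odd (C.filter fun e => G.sign e = -1).card)
    D ⟨hD, hodd⟩
  obtain ⟨heven, hCodd⟩ := hmin.prop
  have hne : C.Nonempty := by
    rw [Finset.nonempty_iff_ne_empty]
    rintro rfl
    simp at hCodd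
  have hsub : ∀ F ⊆ C, (∀ v, Even (G.deg F v)) → F.Nonempty → F = C := by
    intro F hF hFe hFne
    by_cases ho : Odd (F.filter fun e => G.sign e = -1).card
    · exact Finset.Subset.antisymm hF (hmin.2 ⟨hFe, ho⟩ hF)
    · exfalso
      have h1 : ∀ v, Even (G.deg (C \ F) v) := fun v => by
        have := heven v
        rw [← G.deg_sdiff_add hF, Nat.even_add] at this
        exact this.2 (hFe v)
      have h2 : Odd ((C \ F).filter fun e => G.sign e = -1).card := by
        have h3 := Finset.card_sdiff_add_card_eq_card
          (Finset.filter_subset_filter (fun e => G.sign e = -1) hF)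
        have h4 : (C \ F).filter (fun e => G.sign e = -1) =
            C.filter (fun e => G.sign e = -1) \ F.filter (fun e => G.sign e = -1) := by
          ext e
          simp only [Finset.mem_filter, Finset.mem_sdiff]
          tauto
        rw [← h4] at h3
        rw [← h3, Nat.odd_add] at hCodd
        exact hCodd.2 (Nat.not_odd_iff_even.1 ho)
      have h4 : C \ F = C := 
        Finset.Subset.antisymm Finset.sdiff_subset (hmin.2 ⟨h1, h2⟩ Finset.sdiff_subset)
      obtain ⟨e, he⟩ := hFne
      have := hF he
      rw [← h4] at this
      exact (Finset.mem_sdiff.1 this).2 he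
  refine ⟨C, hCD, ⟨hne, ?_, ?_⟩, hCodd⟩
  · set W : Finset V := Finset.univ.filter fun v => G.deg C v ≠ 0 with hW
    have hge : ∀ v ∈ W, 2 ≤ G.deg C v := fun v hv => by
      have h1 := (Finset.mem_filter.1 hv).2
      obtain ⟨r, hr⟩ := heven v
      omega
    have hcard : C.card ≤ W.card := by
      obtain ⟨e₀, he₀⟩ := hne
      have hw₀ : G.a e₀ ∈ W := by
        simp only [hW, Finset.mem_filter, Finset.mem_univ, true_and, ne_eq, deg_eq_zero_iff,
          not_not]
        exact ⟨e₀, he₀, Or.inl rfl⟩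
      set w₀ := G.a e₀
      let x : E → (↥(W.erase w₀) → ZMod 2) := fun e w =>
        (if G.a e = w then 1 else 0) + (if G.b e = w then 1 else 0)
      have hli : LinearIndepOn (ZMod 2) x (↑(C.erase e₀) : Set E) := by
        rw [linearIndepOn_finset_iff]
        intro g hg
        set F := (C.erase e₀).filter fun e => g e ≠ 0 with hF
        have hFC : F ⊆ C := (Finset.filter_subset _ _).trans (Finset.erase_subset _ _)
        have h1 : ∀ v, v ≠ w₀ → (G.deg F v : ZMod 2) = 0 := fun v hv => by
          by_cases hvW : v ∈ W
          · have := congrFun hg ⟨v, Finset.mem_erase.2 ⟨hv, hvW⟩⟩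
            rw [natCast_deg_filter]
            simpa [x] using this
          · have h2 : G.deg C v = 0 := by simpa [hW] using hvW
            have h3 := G.deg_mono hFC v
            have : G.deg F v = 0 := by omega
            simp [this]
        have h2 : ∀ v, (G.deg F v : ZMod 2) = 0 := fun v => by
          by_cases hv : v = w₀
          · have h3 := congrArg (Nat.cast : ℕ → ZMod 2) (G.sum_deg F)
            rw [Nat.cast_sum, Finset.sum_eq_single w₀ (fun v _ hv => h1 v hv) (by simp)] at h3
            rw [hv, h3]
            push_cast
            rw [show (2 : ZMod 2) = 0 from rfl, zero_mul]
          · exact h1 v hv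
        intro e he
        by_contra hge
        have heF : e ∈ F := Finset.mem_filter.2 ⟨he, hge⟩
        have := hsub F hFC (fun v => (ZMod.natCast_eq_zero_iff_even).1 (h2 v)) ⟨e, heF⟩
        rw [← this] at he₀
        simp [hF] at he₀
      have := LinearIndependent.fintype_card_le_finrank hli
      simp only [Module.finrank_fintype_fun_eq_card, Fintype.card_coe, Finset.coe_sort_coe,
        Finset.card_erase_of_mem he₀, Finset.card_erase_of_mem hw₀] at this
      have := Finset.card_pos.2 ⟨_, he₀⟩
      have := Finset.card_pos.2 ⟨_, hw₀⟩
      omega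
    intro v hv
    have hvW : v ∈ W := by
      simp only [hW, Finset.mem_filter, Finset.mem_univ, true_and, ne_eq, deg_eq_zero_iff,
          not_not]
      exact hv
    have hs : ∑ v ∈ W, G.deg C v = 2 * C.card := by
      rw [← G.sum_deg C, hW, Finset.sum_filter_ne_zero]
    have hs' : ∑ v ∈ W, 2 = ∑ v ∈ W, G.deg C v := by
      refine le_antisymm (Finset.sum_le_sum hge) ?_
      rw [hs]
      simp
      omega
    exact ((Finset.sum_eq_sum_iff_of_le hge).1 hs' v hvW).symm
  · intro v w hv hw
    set F := C.filter fun e => Relation.ReflTransGen (G.AdjIn C) v (G.a e) with hF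
    have hstep : ∀ e ∈ C, Relation.ReflTransGen (G.AdjIn C) v (G.a e) ↔
        Relation.ReflTransGen (G.AdjIn C) v (G.b e) := fun e he =>
      ⟨fun h => h.tail ⟨e, he, Or.inl ⟨rfl, rfl⟩⟩, fun h => h.tail ⟨e, he, Or.inr ⟨rfl, rfl⟩⟩⟩
    have hFC : F = C := by
      refine hsub F (Finset.filter_subset _ _) (fun u => ?_) ?_
      · by_cases hu : Relation.ReflTransGen (G.AdjIn C) v u
        · have : G.deg F u = G.deg C u := by
            refine Finset.sum_subset (Finset.filter_subset _ _) fun e he heF => ?_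
            have h1 : ¬ Relation.ReflTransGen (G.AdjIn C) v (G.a e) := fun h =>
              heF (Finset.mem_filter.2 ⟨he, h⟩)
            have h2 := mt (hstep e he).2 h1
            rw [if_neg (fun h : G.a e = u => h1 (h ▸ hu)),
              if_neg (fun h : G.b e = u => h2 (h ▸ hu)), add_zero]
          rw [this]
          exact heven u
        · have : G.deg F u = 0 := by
            rw [deg_eq_zero_iff]
            rintro ⟨e, he, h⟩
            obtain ⟨heC, h1⟩ := Finset.mem_filter.1 he
            rcases h with rfl | rfl
            · exact hu h1
            · exact hu ((hstep e heC).1 h1)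
          simp [this]
      · obtain ⟨e, he, h⟩ := hv
        refine ⟨e, Finset.mem_filter.2 ⟨he, ?_⟩⟩
        rcases h with rfl | rfl
        · exact .refl
        · exact (hstep e he).2 .refl
    obtain ⟨e, he, h⟩ := hw
    have h1 := (Finset.mem_filter.1 (hFC ▸ he : e ∈ F)).2
    rcases h with rfl | rfl
    · exact h1
    · exact (hstep e he).1 h1

theorem exists_signs_of_balancedOn {V E : Type} [Fintype V] [DecidableEq V] [Fintype E]
    (G : SignedGraph V E) (S : Finset E) (h : G.BalancedOn S) :
    ∃ s : V → ℤ, (∀ v, s v = 1 ∨ s v = -1) ∧ ∀ e ∈ S, s (G.b e) = G.sign e * s (G.a e) := by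
  by_cases hs : ∃ s : V → ZMod 2, ∀ e ∈ S,
      s (G.a e) + s (G.b e) = if G.sign e = -1 then 1 else 0
  · obtain ⟨s, hs⟩ := hs
    refine ⟨fun v => if s v = 0 then 1 else -1, fun v => ?_, fun e he => ?_⟩
    · by_cases h : s v = 0 <;> simp [h]
    · have h1 := hs e he
      have key : ∀ x y : ZMod 2,
          (x + y = 1 → (x = 0 ↔ ¬ y = 0)) ∧ (x + y = 0 → (x = 0 ↔ y = 0)) := by
        decide
      obtain ⟨k1, k2⟩ := key (s (G.a e)) (s (G.b e))
      rcases G.sign_unit e with h2 | h2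
      · rw [h2, if_neg (by decide)] at h1
        simp [h2, k2 h1]
      · rw [h2, if_pos rfl] at h1
        have := k1 h1
        by_cases h3 : s (G.b e) = 0 <;> simp [h2, h3, this]
  · obtain ⟨D, hDS, hD, hodd⟩ := G.exists_even_odd_of_not_switchable S hs
    obtain ⟨C, hCD, hC⟩ := G.exists_unbalancedCircuit_of_even_odd D hD hodd
    exact absurd hC (h C (hCD.trans hDS))

theorem exists_signs_of_not_compUnbalanced {V E : Type} [Fintype V] [DecidableEq V] [Fintype E]
    (G : SignedGraph V E) (q : Quotient G.compSetoid) (h : ¬ G.CompUnbalanced q) :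
    ∃ s : V → ℤ, (∀ v, s v = 1 ∨ s v = -1) ∧
      ∀ e, G.component (G.a e) = q → s (G.b e) = G.sign e * s (G.a e) := by
  classical
  obtain ⟨s, hs, hs'⟩ := G.exists_signs_of_balancedOn
    (Finset.univ.filter fun e => G.component (G.a e) = q) (fun C hC hCu => h (by
      obtain ⟨e, he⟩ := hCu.1.1
      exact ⟨C, hCu, e, he, (Finset.mem_filter.1 (hC he)).2⟩))
  exact ⟨s, hs, fun e he => hs' e (by simp [he])⟩

/-- A function on the vertices that is transported along every edge according to its sign. -/
def IsPotential {V E A : Type} [AddCommGroup A] (G : SignedGraph V E) (y : V → A) : Prop :=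
  ∀ e, y (G.b e) = G.sign e • y (G.a e)

theorem component_a_eq_b {V E : Type} (G : SignedGraph V E) (e : E) :
    G.component (G.a e) = G.component (G.b e) :=
  Quotient.sound (Relation.EqvGen.rel _ _ ⟨e, Or.inl ⟨rfl, rfl⟩⟩)

/-- Along a connected component, a relation invariant under all edges holds between
any two vertices. -/
theorem rel_of_component_eq {V E : Type} (G : SignedGraph V E) (r : V → V → Prop)
    (hr : Equivalence r) {v w : V} (h : G.component v = G.component w)
    (hE : ∀ e, G.component (G.a e) = G.component v → r (G.a e) (G.b e)) : r v w := by
  have h' : Relation.EqvGen G.Adj v w := Quotient.exact h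
  clear h
  induction h' with
  | rel x y hxy =>
    obtain ⟨e, ⟨rfl, rfl⟩ | ⟨rfl, rfl⟩⟩ := hxy
    · exact hE e rfl
    · exact hr.symm (hE e (G.component_a_eq_b e))
  | refl x => exact hr.refl x
  | symm x y hxy ih =>
    have : G.component x = G.component y := Quotient.sound hxy
    exact hr.symm (ih fun e he => hE e (he.trans this))
  | trans x y z hxy _ ih1 ih2 =>
    have : G.component x = G.component y := Quotient.sound hxy
    exact hr.trans (ih1 hE) (ih2 fun e he => hE e (he.trans this.symm))

theorem eq_or_eq_neg_of_component_eq {V E A : Type} [AddCommGroup A] (G : SignedGraph V E)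
    {y : V → A} {v w : V} (h : G.component v = G.component w)
    (hy : ∀ e, G.component (G.a e) = G.component v → y (G.b e) = G.sign e • y (G.a e)) :
    y v = y w ∨ y v = -y w := by
  refine G.rel_of_component_eq (fun v w => y v = y w ∨ y v = -y w)
    ⟨fun _ => Or.inl rfl, ?_, ?_⟩ h ?_
  · rintro v w (h | h) <;> simp [h]
  · rintro u v w (h | h) (h' | h') <;> simp [h, h']
  · intro e he
    rcases G.sign_unit e with h1 | h1 <;> simp [hy e he, h1]

theorem prod_sign_eq_one {V E : Type} [Fintype V] [DecidableEq V] (G : SignedGraph V E)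
    (C : Finset E) (hC : ∀ v, Even (G.deg C v)) (s : V → ℤ) (hs : ∀ v, s v = 1 ∨ s v = -1)
    (h : ∀ e ∈ C, G.sign e = s (G.a e) * s (G.b e)) : ∏ e ∈ C, G.sign e = 1 := by
  have h1 : ∏ e ∈ C, G.sign e = ∏ v, s v ^ G.deg C v := by
    unfold deg
    simp_rw [← Finset.prod_pow_eq_pow_sum]
    rw [Finset.prod_comm]
    refine Finset.prod_congr rfl fun e he => ?_
    simp only [pow_add, Finset.prod_mul_distrib, pow_ite, pow_one, pow_zero, h e he]
    simp
  rw [h1]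
  refine Finset.prod_eq_one fun v _ => ?_
  rcases hs v with h2 | h2
  · simp [h2]
  · rw [h2, (hC v).neg_one_pow]

theorem prod_sign_eq_neg_one_pow {V E : Type} (G : SignedGraph V E) (C : Finset E) :
    ∏ e ∈ C, G.sign e = (-1) ^ (C.filter fun e => G.sign e = -1).card := by
  rw [← Finset.prod_const, Finset.prod_filter]
  refine Finset.prod_congr rfl fun e _ => ?_
  rcases G.sign_unit e with h | h <;> simp [h]

/-- On an unbalanced component every value of a potential is an involution. -/
theorem two_nsmul_eq_zero_of_compUnbalanced {V E A : Type} [Fintype V] [DecidableEq V]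
    [AddCommGroup A] (G : SignedGraph V E) {q : Quotient G.compSetoid} (hq : G.CompUnbalanced q)
    {y : V → A} (hy : ∀ e, G.component (G.a e) = q → y (G.b e) = G.sign e • y (G.a e))
    {v : V} (hv : G.component v = q) : 2 • y v = 0 := by
  classical
  obtain ⟨C, ⟨⟨-, hdeg, hconn⟩, hodd⟩, e₀, he₀, rfl⟩ := hq
  by_contra hne
  have hcomp : ∀ w, (∃ e ∈ C, G.a e = w ∨ G.b e = w) → G.component v = G.component w := by
    intro w hw
    rw [hv]
    have h1 := hconn (G.a e₀) w ⟨e₀, he₀, Or.inl rfl⟩ hw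
    clear hw
    induction h1 with
    | refl => rfl
    | tail _ h2 ih =>
      obtain ⟨e, _, ⟨rfl, rfl⟩ | ⟨rfl, rfl⟩⟩ := h2
      · exact ih.trans (G.component_a_eq_b e)
      · exact ih.trans (G.component_a_eq_b e).symm
  have hpm : ∀ w, (∃ e ∈ C, G.a e = w ∨ G.b e = w) → y w = y v ∨ y w = -y v := by
    intro w hw
    refine G.eq_or_eq_neg_of_component_eq (hcomp w hw).symm fun e he => ?_
    exact hy e (he.trans ((hcomp w hw).symm.trans hv))
  have hyv : -y v ≠ y v := fun h => hne (by rw [two_nsmul, ← neg_eq_iff_add_eq_zero, h])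
  have h1 := G.prod_sign_eq_one C (fun w => by
      by_cases hw : ∃ e ∈ C, G.a e = w ∨ G.b e = w
      · rw [hdeg w hw]
        exact even_two
      · rw [(G.deg_eq_zero_iff C w).2 hw]
        exact Even.zero)
    (fun w => if y w = y v then 1 else -1) (fun w => by
      by_cases h : y w = y v <;> simp [h]) (fun e he => by
      have ha := hpm (G.a e) ⟨e, he, Or.inl rfl⟩
      have hab := hy e ((hcomp (G.a e) ⟨e, he, Or.inl rfl⟩).symm.trans hv)
      rcases G.sign_unit e with hσ | hσ <;> rcases ha with ha | ha <;>
        simp [hσ, hab, ha, hyv])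
  rw [prod_sign_eq_neg_one_pow, hodd.neg_one_pow] at h1
  exact absurd h1 (by decide)

/-- Potentials are determined by one value on each component, which is arbitrary on a balanced
component and an arbitrary involution on an unbalanced one. -/
theorem card_isPotential {V E A : Type} [Fintype V] [DecidableEq V] [Fintype E]
    [AddCommGroup A] (G : SignedGraph V E) [Fintype (Quotient G.compSetoid)]
    [DecidablePred G.CompUnbalanced] :
    Nat.card {y : V → A // G.IsPotential y} =
      ∏ q, if G.CompUnbalanced q then Nat.card {x : A // 2 • x = 0} else Nat.card A := by
  have hout : ∀ q : Quotient G.compSetoid, G.component q.out = q := fun q => q.out_eq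
  let ev : {y : V → A // G.IsPotential y} →
      ∀ q : Quotient G.compSetoid, {x : A // G.CompUnbalanced q → 2 • x = 0} := fun y q =>
    ⟨y.1 q.out, fun hq =>
      G.two_nsmul_eq_zero_of_compUnbalanced hq (fun e _ => y.2 e) (hout q)⟩
  have hinj : Function.Injective ev := by
    intro y z hyz
    ext v
    have h1 : y.1 (G.component v).out = z.1 (G.component v).out :=
      congrArg Subtype.val (congrFun hyz (G.component v))
    have h2 := G.rel_of_component_eq
      (fun v w => y.1 v - z.1 v = y.1 w - z.1 w ∨ y.1 v - z.1 v = -(y.1 w - z.1 w))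
      ⟨fun _ => Or.inl rfl, by rintro v w (h | h) <;> simp [h],
        by rintro u v w (h | h) (h' | h') <;> simp [h, h']⟩ (hout (G.component v)).symm
      (fun e _ => by
        rcases G.sign_unit e with h | h
        · simp [y.2 e, z.2 e, h]
        · right; simp [y.2 e, z.2 e, h]; abel)
    rw [h1] at h2
    simpa [sub_eq_zero] using h2
  have hsurj : Function.Surjective ev := by
    intro t
    have hs : ∀ q : Quotient G.compSetoid, ∃ s : V → ℤ, (∀ v, s v = 1 ∨ s v = -1) ∧
        (¬ G.CompUnbalanced q →
          ∀ e, G.component (G.a e) = q → s (G.b e) = G.sign e * s (G.a e)) := by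
      intro q
      by_cases hq : G.CompUnbalanced q
      · exact ⟨fun _ => 1, fun _ => Or.inl rfl, fun h => absurd hq h⟩
      · obtain ⟨s, h1, h2⟩ := G.exists_signs_of_not_compUnbalanced q hq
        exact ⟨s, h1, fun _ => h2⟩
    choose s hs1 hs2 using hs
    refine ⟨⟨fun v => (s (G.component v) v * s (G.component v) (G.component v).out) •
      (t (G.component v)).1, fun e => ?_⟩, ?_⟩
    · dsimp only
      rw [← G.component_a_eq_b e]
      by_cases hq : G.CompUnbalanced (G.component (G.a e))
      · have h2 := (t (G.component (G.a e))).2 hq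
        rw [two_nsmul, add_eq_zero_iff_eq_neg] at h2
        rcases hs1 (G.component (G.a e)) (G.a e) with h | h <;>
        rcases hs1 (G.component (G.a e)) (G.b e) with h' | h' <;>
        rcases G.sign_unit e with h3 | h3 <;>
        rcases hs1 (G.component (G.a e)) (G.component (G.a e)).out with h4 | h4 <;>
        simp [h, h', h3, h4, ← h2]
      · rw [hs2 _ hq e rfl, smul_smul, mul_assoc]
    · funext q
      apply Subtype.ext
      simp only [ev]
      rw [hout]
      rcases hs1 q q.out with h | h <;> simp [h]
  rw [Nat.card_congr (Equiv.ofBijective ev ⟨hinj, hsurj⟩), Nat.card_pi]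
  refine Finset.prod_congr rfl fun q _ => ?_
  split_ifs with hq
  · simp [hq]
  · simp [hq]

/-- A component has at least as many edges as vertices, or one less if it is balanced. -/
theorem compN_le {V E : Type} [Fintype V] [DecidableEq V] [Fintype E]
    (G : SignedGraph V E) (q : Quotient G.compSetoid) :
    G.compN q ≤ G.compM q + 1 ∧ (G.CompUnbalanced q → G.compN q ≤ G.compM q) := by
  classical
  let Φ : ({v : V // G.component v = q} → ZMod 3) →+
      ({e : E // G.component (G.a e) = q} → ZMod 3) :=
    { toFun := fun y e => y ⟨G.b e.1, (G.component_a_eq_b e.1).symm.trans e.2⟩ -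
        G.sign e.1 • y ⟨G.a e.1, e.2⟩
      map_zero' := by ext; simp
      map_add' := fun x y => by ext; simp; ring }
  have hcard : 3 ^ G.compN q ≤ Nat.card Φ.ker * 3 ^ G.compM q := by
    have h1 := AddSubgroup.card_mul_index Φ.ker
    rw [AddSubgroup.index_ker] at h1
    have h2 : Nat.card Φ.range ≤ Nat.card ({e : E // G.component (G.a e) = q} → ZMod 3) :=
      Nat.card_le_card_of_injective _ Subtype.val_injective
    rw [Nat.card_fun, Nat.card_zmod] at h1 h2
    calc 3 ^ G.compN q = _ := h1.symm
      _ ≤ _ := Nat.mul_le_mul_left _ h2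
  let extend : ({v : V // G.component v = q} → ZMod 3) → V → ZMod 3 := fun y v =>
    if h : G.component v = q then y ⟨v, h⟩ else 0
  have hext : ∀ y ∈ Φ.ker, ∀ e, G.component (G.a e) = q →
      extend y (G.b e) = G.sign e • extend y (G.a e) := by
    intro y hy e he
    have h1 := congrFun (AddMonoidHom.mem_ker.1 hy) ⟨e, he⟩
    have h2 := (G.component_a_eq_b e).symm.trans he
    simp only [extend, dif_pos he, dif_pos h2]
    exact sub_eq_zero.1 h1
  have hroot : G.component q.out = q := q.out_eq
  have hzero : ∀ y ∈ Φ.ker, y ⟨q.out, hroot⟩ = 0 → y = 0 := by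
    intro y hy h0
    ext ⟨v, hv⟩
    have h1 := G.eq_or_eq_neg_of_component_eq (y := extend y) (hv.trans hroot.symm)
      (fun e he => hext y hy e (he.trans hv))
    simpa [extend, hv, hroot, h0] using h1
  have hle : Nat.card Φ.ker ≤ 3 := by
    have : Function.Injective fun y : Φ.ker => y.1 ⟨q.out, hroot⟩ := by
      intro x y hxy
      have := hzero (x.1 - y.1) (Φ.ker.sub_mem x.2 y.2) (by simpa [sub_eq_zero] using hxy)
      exact Subtype.ext (sub_eq_zero.1 this)
    simpa using Nat.card_le_card_of_injective _ this
  constructor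
  · refine (Nat.pow_le_pow_iff_right (by norm_num : 1 < 3)).1 (hcard.trans ?_)
    rw [pow_succ, mul_comm]
    exact Nat.mul_le_mul_left _ hle
  · intro hq
    have hbot : Nat.card Φ.ker = 1 := by
      rw [AddSubgroup.card_eq_one, AddSubgroup.eq_bot_iff_forall]
      intro y hy
      refine hzero y hy ?_
      have h1 := G.two_nsmul_eq_zero_of_compUnbalanced hq (hext y hy) hroot
      have h2 : ∀ x : ZMod 3, 2 • x = 0 → x = 0 := by decide
      have h3 := h2 _ h1
      simpa [extend, hroot] using h3
    rw [hbot, one_mul] at hcard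
    exact (Nat.pow_le_pow_iff_right (by norm_num : 1 < 3)).1 hcard

end SignedGraph

/-- The involutions of a finite abelian group form an elementary abelian group of
rank `epsilon`. -/
theorem card_two_nsmul_eq_zero (Γ : Type) [AddCommGroup Γ] [Fintype Γ] :
    Nat.card {x : Γ // 2 • x = 0} = 2 ^ epsilon Γ := by
  classical
  let T : AddSubgroup Γ := (nsmulAddMonoidHom 2 : Γ →+ Γ).ker
  have hT : ∀ x : Γ, x ∈ T ↔ 2 • x = 0 := fun x => AddMonoidHom.mem_ker
  have hT' : Nat.card {x : Γ // 2 • x = 0} = Nat.card T :=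
    Nat.card_congr (Equiv.subtypeEquivRight fun x => (hT x).symm)
  let _ : Module (ZMod 2) T :=
    AddCommGroup.zmodModule fun x => Subtype.ext ((hT x.1).1 x.2)
  let B := Module.finBasis (ZMod 2) T
  have hcard : Nat.card T = 2 ^ Module.finrank (ZMod 2) T := by
    rw [Nat.card_congr B.equivFun.toEquiv]
    simp
  have hgreatest : IsGreatest {d : ℕ | ∃ H : AddSubgroup Γ, Nonempty (H ≃+ (Fin d → ZMod 2))}
      (Module.finrank (ZMod 2) T) := by
    refine ⟨⟨T, ⟨B.equivFun.toAddEquiv⟩⟩, ?_⟩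
    rintro d ⟨H, ⟨φ⟩⟩
    have hHT : H ≤ T := by
      intro x hx
      rw [hT]
      have h1 : 2 • (⟨x, hx⟩ : H) = 0 := by
        apply φ.injective
        rw [map_nsmul, map_zero]
        ext i
        have : ∀ z : ZMod 2, 2 • z = 0 := by decide
        exact this _
      exact congrArg Subtype.val h1
    have h2 : Nat.card H = 2 ^ d := by
      rw [Nat.card_congr φ.toEquiv]
      simp
    have h3 := Nat.card_le_card_of_injective _ (AddSubgroup.inclusion_injective hHT)
    rw [h2, hcard] at h3
    exact (Nat.pow_le_pow_iff_right (by norm_num)).1 h3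
  rw [hT', hcard, epsilon, hgreatest.csSup_eq]

/-- A finite abelian group is self-dual: it carries a perfect pairing with values in `ℂˣ`. -/
theorem exists_perfect_pairing (Γ : Type) [AddCommGroup Γ] [Fintype Γ] [DecidableEq Γ] :
    ∃ B : Γ →+ Γ →+ Additive ℂˣ,
      (∀ y, ∑ x, ((B y x).toMul : ℂ) = if y = 0 then (Fintype.card Γ : ℂ) else 0) ∧
      (∀ x, ∑ y, ((B y x).toMul : ℂ) = if x = 0 then (Fintype.card Γ : ℂ) else 0) := by
  classical
  obtain ⟨φ⟩ := CommGroup.monoidHom_mulEquiv_of_hasEnoughRootsOfUnity (Multiplicative Γ) ℂ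
  let B : Γ →+ Γ →+ Additive ℂˣ :=
    { toFun := fun y => MonoidHom.toAdditiveRight (φ.symm (Multiplicative.ofAdd y))
      map_zero' := by ext; simp
      map_add' := fun x y => by ext; simp }
  have hB : ∀ χ : Γ →+ Additive ℂˣ,
      ∑ x, ((χ x).toMul : ℂ) = if χ = 0 then (Fintype.card Γ : ℂ) else 0 := by
    intro χ
    have h1 := sum_hom_units ((Units.coeHom ℂ).comp (AddMonoidHom.toMultiplicativeLeft χ))
    rw [Nat.cast_ite, Nat.cast_zero] at h1
    refine Eq.trans ?_ (h1.trans ?_)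
    · exact Fintype.sum_equiv Multiplicative.ofAdd _ _ fun x => rfl
    · rw [Fintype.card_multiplicative]
      refine if_congr ⟨fun h => ?_, fun h => ?_⟩ rfl rfl
      · ext x
        exact DFunLike.congr_fun h (Multiplicative.ofAdd x)
      · ext x
        simp [h]
  refine ⟨B, fun y => ?_, fun x => ?_⟩
  · rw [hB]
    refine if_congr ⟨fun h => ?_, fun h => by rw [h, map_zero]⟩ rfl rfl
    have h1 : φ.symm (Multiplicative.ofAdd y) = 1 := by
      refine MonoidHom.ext fun x => ?_
      exact DFunLike.congr_fun h x.toAdd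
    simpa using h1
  · refine (hB (B.flip x)).trans ?_
    refine if_congr ⟨fun h => ?_, fun h => by rw [h, map_zero]⟩ rfl rfl
    by_contra hx
    obtain ⟨χ, hχ⟩ := CommGroup.exists_apply_ne_one_of_hasEnoughRootsOfUnity
      (Multiplicative Γ) ℂ (a := Multiplicative.ofAdd x) hx
    have h1 := DFunLike.congr_fun h (φ χ).toAdd
    have h2 : (φ.symm (φ χ)) (Multiplicative.ofAdd x) = 1 := h1
    rw [φ.symm_apply_apply] at h2
    exact hχ h2

namespace SignedGraph

/-- Duality between flows and potentials. -/
theorem card_isFlow_mul {V E Γ : Type} [Fintype V] [DecidableEq V] [Fintype E]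
    [AddCommGroup Γ] [Fintype Γ] (G : SignedGraph V E) (O : G.Orientation) :
    Nat.card {f : E → Γ // G.IsFlow O f} * Fintype.card Γ ^ Fintype.card V =
      Nat.card {y : V → Γ // G.IsPotential y} * Fintype.card Γ ^ Fintype.card E := by
  classical
  obtain ⟨B, hB1, hB2⟩ := exists_perfect_pairing Γ
  let c : V → E → ℤ := fun v e =>
    (if G.a e = v then O.ηa e else 0) + (if G.b e = v then O.ηb e else 0)
  have hswap : ∀ (y : V → Γ) (f : E → Γ),
      ∑ v, B (y v) (∑ e, c v e • f e) = ∑ e, B (∑ v, c v e • y v) (f e) := by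
    intro y f
    simp only [map_sum, map_zsmul, AddMonoidHom.finsetSum_apply, AddMonoidHom.zsmul_apply]
    exact Finset.sum_comm
  have hpot : ∀ y : V → Γ, (∀ e, ∑ v, c v e • y v = 0) ↔ G.IsPotential y := by
    intro y
    refine forall_congr' fun e => ?_
    simp only [c, add_smul, Finset.sum_add_distrib, ite_smul, zero_smul, Finset.sum_ite_eq,
      Finset.mem_univ, if_true]
    have h1 := O.compat e
    rcases O.ηa_unit e with h2 | h2 <;> rcases O.ηb_unit e with h3 | h3 <;>
      rcases G.sign_unit e with h4 | h4 <;> simp [h2, h3, h4] at h1 ⊢ <;>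
      grind
  have hzero : ∀ {I : Type} [Fintype I] [DecidableEq I] (x : I → Γ),
      ∏ i, (if x i = 0 then (Fintype.card Γ : ℂ) else 0) =
        if ∀ i, x i = 0 then (Fintype.card Γ : ℂ) ^ Fintype.card I else 0 := by
    intro I _ _ x
    split_ifs with h
    · simp [h]
    · push Not at h
      obtain ⟨i, hi⟩ := h
      exact Finset.prod_eq_zero (Finset.mem_univ i) (by simp [hi])
  have hL : ∀ f : E → Γ, ∑ y : V → Γ, ((∑ v, B (y v) (∑ e, c v e • f e)).toMul : ℂ) =
      if G.IsFlow O f then (Fintype.card Γ : ℂ) ^ Fintype.card V else 0 := by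
    intro f
    simp only [toMul_sum, Units.coe_prod]
    rw [← Fintype.prod_sum (fun v z => ((B z (∑ e, c v e • f e)).toMul : ℂ))]
    simp only [hB2]
    exact (hzero fun v => ∑ e, c v e • f e).trans (if_congr Iff.rfl rfl rfl)
  have hR : ∀ y : V → Γ, ∑ f : E → Γ, ((∑ e, B (∑ v, c v e • y v) (f e)).toMul : ℂ) =
      if G.IsPotential y then (Fintype.card Γ : ℂ) ^ Fintype.card E else 0 := by
    intro y
    simp only [toMul_sum, Units.coe_prod]
    rw [← Fintype.prod_sum (fun e z => ((B (∑ v, c v e • y v) z).toMul : ℂ))]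
    simp only [hB1]
    rw [hzero (fun e => ∑ v, c v e • y v), if_congr (hpot y) rfl rfl]
  have key : ∑ f : E → Γ, (if G.IsFlow O f then (Fintype.card Γ : ℂ) ^ Fintype.card V else 0) =
      ∑ y : V → Γ, if G.IsPotential y then (Fintype.card Γ : ℂ) ^ Fintype.card E else 0 := by
    simp only [← hL, ← hR, ← hswap]
    exact Finset.sum_comm
  rw [← Finset.sum_filter, ← Finset.sum_filter, Finset.sum_const, Finset.sum_const,
    nsmul_eq_mul, nsmul_eq_mul] at key
  rw [Nat.card_eq_fintype_card, Nat.card_eq_fintype_card, Fintype.card_subtype,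
    Fintype.card_subtype]
  exact_mod_cast key

/-- The number of flows of a signed graph. -/
theorem card_isFlow {V E Γ : Type} [Fintype V] [DecidableEq V] [Fintype E]
    [AddCommGroup Γ] [Fintype Γ] (G : SignedGraph V E) (O : G.Orientation) :
    Nat.card {f : E → Γ // G.IsFlow O f} =
      2 ^ (epsilon Γ * G.kappa) * Fintype.card Γ ^ G.beta := by
  classical
  have : Fintype (Quotient G.compSetoid) := Fintype.ofFinite _
  have hk : 0 < Fintype.card Γ := Fintype.card_pos
  have hn : ∑ q, G.compN q = Fintype.card V := by
    have h1 := Fintype.card_congr (Equiv.sigmaFiberEquiv G.component)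
    rw [Fintype.card_sigma] at h1
    simpa [compN] using h1
  have hm : ∑ q, G.compM q = Fintype.card E := by
    have h1 := Fintype.card_congr (Equiv.sigmaFiberEquiv fun e => G.component (G.a e))
    rw [Fintype.card_sigma] at h1
    simpa [compM] using h1
  have hκ : (2 : ℕ) ^ (epsilon Γ * G.kappa) =
      ∏ q, if G.CompUnbalanced q then 2 ^ epsilon Γ else 1 := by
    rw [Finset.prod_ite, Finset.prod_const, Finset.prod_const_one, mul_one, pow_mul, kappa,
      Nat.card_eq_fintype_card, Fintype.card_subtype]
  refine Nat.eq_of_mul_eq_mul_right (pow_pos hk (Fintype.card V)) ?_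
  rw [card_isFlow_mul, card_isPotential, hκ, beta, finsum_eq_sum_of_fintype, ← hn, ← hm,
    ← Finset.prod_pow_eq_pow_sum, ← Finset.prod_pow_eq_pow_sum, ← Finset.prod_pow_eq_pow_sum,
    ← Finset.prod_mul_distrib, ← Finset.prod_mul_distrib, ← Finset.prod_mul_distrib]
  refine Finset.prod_congr rfl fun q _ => ?_
  obtain ⟨h1, h2⟩ := G.compN_le q
  unfold compBeta
  by_cases hq : G.CompUnbalanced q
  · simp only [if_pos hq]
    rw [card_two_nsmul_eq_zero, mul_assoc, ← pow_add, Nat.sub_add_cancel (h2 hq)]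
  · simp only [if_neg hq]
    rw [one_mul, ← pow_add, Nat.sub_add_cancel h1, Nat.card_eq_fintype_card, pow_succ, mul_comm]

/-- The orientation of `G - F` induced by an orientation of `G`. -/
def Orientation.delete {V E : Type} [DecidableEq E] {G : SignedGraph V E} (O : G.Orientation)
    (F : Finset E) : (G.delete F).Orientation :=
  ⟨fun e => O.ηa e.1, fun e => O.ηb e.1, fun e => O.ηa_unit e.1, fun e => O.ηb_unit e.1,
    fun e => O.compat e.1⟩

theorem isFlow_delete_iff {V E Γ : Type} [DecidableEq V] [Fintype E] [DecidableEq E]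
    [AddCommGroup Γ] (G : SignedGraph V E) (O : G.Orientation) (F : Finset E) (f : E → Γ)
    (hf : ∀ e ∈ F, f e = 0) :
    (G.delete F).IsFlow (O.delete F) (fun e => f e.1) ↔ G.IsFlow O f := by
  refine forall_congr' fun v => ?_
  rw [← Finset.sum_filter_add_sum_filter_not Finset.univ (· ∉ F),
    Finset.sum_eq_zero (s := Finset.univ.filter (¬ · ∉ F)) fun e he => ?_, add_zero,
    Finset.sum_subtype (p := (· ∉ F)) (Finset.univ.filter (· ∉ F)) (by simp)]
  · exact Iff.rfl
  · rw [hf e (by simpa using he), smul_zero]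

/-- Flows of `G - F` are the flows of `G` vanishing on `F`. -/
theorem card_isFlow_delete {V E Γ : Type} [DecidableEq V] [Fintype E] [DecidableEq E]
    [AddCommGroup Γ] (G : SignedGraph V E) (O : G.Orientation) (F : Finset E) :
    Nat.card {f : E → Γ // G.IsFlow O f ∧ ∀ e ∈ F, f e = 0} =
      Nat.card {g : {e // e ∉ F} → Γ // (G.delete F).IsFlow (O.delete F) g} := by
  refine Nat.card_congr
    ⟨fun f => ⟨fun e => f.1 e.1, (G.isFlow_delete_iff O F f.1 f.2.2).2 f.2.1⟩,
      fun g => ⟨fun e => if h : e ∉ F then g.1 ⟨e, h⟩ else 0, ?_, fun e he => by simp [he]⟩,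
      fun f => ?_, fun g => ?_⟩
  · rw [← G.isFlow_delete_iff O F _ fun e he => by simp [he]]
    convert g.2 with e
    simp [e.2]
  · ext e
    by_cases he : e ∈ F
    · simp [he, f.2.2 e he]
    · simp [he]
  · ext e
    simp [e.2]

end SignedGraph

/-- Inclusion–exclusion expression for the number of nowhere-zero
`Γ`-flows in a signed graph `G`:
`∑_{F ⊆ E} (-1)^{|F|} · 2^{ε(Γ)·κ(G-F)} · k^{β(G-F)}`. -/
theorem nowhere_zero_flow_count_incl_excl {V E : Type}
    [Fintype V] [DecidableEq V] [Fintype E] [DecidableEq E]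
    (G : SignedGraph V E) (O : G.Orientation)
    (Γ : Type) [AddCommGroup Γ] [Fintype Γ] (k : ℕ) (hk : Fintype.card Γ = k) :
    (Nat.card {f : E → Γ // G.IsFlow O f ∧ ∀ e, f e ≠ 0} : ℤ) =
      ∑ F : Finset E, (-1 : ℤ) ^ F.card * 2 ^ (epsilon Γ * (G.delete F).kappa) *
        (k : ℤ) ^ (G.delete F).beta := by
  classical
  subst hk
  have hterm : ∀ F : Finset E, (-1 : ℤ) ^ F.card * 2 ^ (epsilon Γ * (G.delete F).kappa) *
      ((Fintype.card Γ : ℕ) : ℤ) ^ (G.delete F).beta =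
      ∑ f : E → Γ, if G.IsFlow O f then ∏ e ∈ F, (-(if f e = 0 then 1 else 0) : ℤ) else 0 := by
    intro F
    have h1 := G.card_isFlow_delete (Γ := Γ) O F
    rw [(G.delete F).card_isFlow (O.delete F), Nat.card_eq_fintype_card,
      Fintype.card_subtype] at h1
    rw [mul_assoc]
    have h2 := congrArg (Nat.cast : ℕ → ℤ) h1
    push_cast at h2
    rw [← h2, Finset.card_filter, Nat.cast_sum, Finset.mul_sum]
    refine Finset.sum_congr rfl fun f _ => ?_
    rw [Finset.prod_neg, Finset.prod_ite_zero, Finset.prod_const_one]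
    by_cases h3 : G.IsFlow O f <;> by_cases h4 : ∀ e ∈ F, f e = 0 <;> simp [h3, h4]
  simp only [hterm]
  rw [Finset.sum_comm, Nat.card_eq_fintype_card, Fintype.card_subtype, Finset.card_filter,
    Nat.cast_sum]
  refine Finset.sum_congr rfl fun f _ => ?_
  by_cases hf : G.IsFlow O f
  · simp only [hf, true_and, if_true]
    rw [← Finset.powerset_univ, ← Finset.prod_one_add, Nat.cast_ite, Nat.cast_one, Nat.cast_zero]
    split_ifs with h
    · simp [h]
    · push Not at h
      obtain ⟨e, he⟩ := h
      exact (Finset.prod_eq_zero (Finset.mem_univ e) (by simp [he])).symm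
  · simp [hf]
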